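/- With P, P', Q and the scoring vector s as in Reduction 3 from the 3DM instance (described in the context), the distinguished candidate c is a possible winner of the partial profile P ∪ Q under s if and only if the 3DM instance is positive. -/

import Mathlib

/-- The score of candidate `c` in a profile (a list of votes) under scoring vector `s`.
A vote assigns each candidate a position in `Fin m` (position `0` being most preferred). -/
def score {C : Type*} {m : ℕ} (s : Fin m → ℕ) (P : List (C ≃ Fin m)) (c : C) : ℕ :=
  (P.map fun T => s (T c)).sum

/-- `prefL n ℓ k` is the sum of the block lengths `ℓ j` over `j < k`:
the (0-indexed) first position of the `k`-th block of the scoring vector. -/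
def prefL (n : ℕ) (ℓ : Fin n → ℕ) (k : ℕ) : ℕ :=
  ∑ j : Fin n, if (j : ℕ) < k then ℓ j else 0

/-- Candidates of Reduction 3: the element candidates of `X`, `Y`, `Z` (each of size `q`),
the distinguished candidate `c`, the fresh candidates `g`, `d`, `w`, and for each value
block `j` of the scoring vector (with multiplicity `ℓ j`) a set `H_j` of `ℓ j − 1` dummy
candidates. -/
inductive CandU (q : ℕ) (ℓ : Fin (3 * q + 4) → ℕ) where
  | x (i : Fin q)
  | y (i : Fin q)
  | z (i : Fin q)
  | c
  | g
  | d
  | w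
  | h (j : Fin (3 * q + 4)) (k : Fin (ℓ j - 1))

lemma prefL_zero {n : ℕ} (ℓ : Fin n → ℕ) : prefL n ℓ 0 = 0 := by
  simp [prefL]

lemma prefL_succ {n : ℕ} (ℓ : Fin n → ℕ) (j : Fin n) :
    prefL n ℓ (j + 1) = prefL n ℓ j + ℓ j := by
  have h : ∀ i : Fin n, (if (i : ℕ) < j + 1 then ℓ i else 0) =
      (if (i : ℕ) < j then ℓ i else 0) + if i = j then ℓ i else 0 := by
    intro i
    rcases lt_trichotomy (i : ℕ) j with hij | hij | hij
    · have : i ≠ j := by rintro rfl; omega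
      simp [hij, this, Nat.lt_succ_of_lt hij]
    · have : i = j := Fin.ext hij
      simp [this]
    · have : i ≠ j := by rintro rfl; omega
      simp [this, show ¬ (i : ℕ) < j + 1 by omega, show ¬ (i : ℕ) < j by omega]
  simp only [prefL, h, Finset.sum_add_distrib, Finset.sum_ite_eq',
    Finset.mem_univ, if_true]

lemma prefL_mono {n : ℕ} (ℓ : Fin n → ℕ) : Monotone (prefL n ℓ) := by
  intro k k' hk
  refine Finset.sum_le_sum fun i _ => ?_
  split_ifs <;> omega

/-- Every position lies in some block. -/
lemma exists_block {n : ℕ} (ℓ : Fin n → ℕ) {p : ℕ} (hp : p < prefL n ℓ n) :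
    ∃ j : Fin n, prefL n ℓ j ≤ p ∧ p < prefL n ℓ (j + 1) := by
  have key : ∀ k ≤ n, p < prefL n ℓ k →
      ∃ j : Fin n, prefL n ℓ j ≤ p ∧ p < prefL n ℓ (j + 1) := by
    intro k
    induction k with
    | zero => intro _ h; simp [prefL_zero] at h
    | succ k ih =>
      intro hk h
      rcases lt_or_ge p (prefL n ℓ k) with h' | h'
      · exact ih (by omega) h'
      · exact ⟨⟨k, by omega⟩, h', h⟩
  exact key n le_rfl hp

lemma score_ofFn_append {C : Type*} {m t : ℕ} (s : Fin m → ℕ) (T : Fin t → (C ≃ Fin m))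
    (Q : List (C ≃ Fin m)) (u : C) :
    score s (List.ofFn T ++ Q) u = ∑ i, s (T i u) + score s Q u := by
  simp [score, List.map_ofFn, List.sum_ofFn]

/-- If two votes agree off `g`, then the positions of any other candidate in the two votes
differ only according to whether `g` precedes it. -/
lemma exists_common_rank {C : Type*} {m : ℕ} (e T : C ≃ Fin m) (g : C)
    (h : ∀ u v, u ≠ g → v ≠ g → e u < e v → T u < T v) (u : C) (hu : u ≠ g) :
    ∃ r : ℕ, (e u : ℕ) = r + (if e g < e u then 1 else 0) ∧
      (T u : ℕ) = r + (if T g < T u then 1 else 0) := by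
  have card (f : C ≃ Fin m) :
      (f u : ℕ) = ((Finset.Iio (f u)).erase (f g)).card + if f g < f u then 1 else 0 := by
    split_ifs with hlt
    · rw [Finset.card_erase_add_one (by simpa using hlt), Fin.card_Iio]
    · rw [Finset.erase_eq_of_notMem (by simpa using hlt), Fin.card_Iio, add_zero]
  refine ⟨_, card e, ?_⟩
  have hiff : ∀ v, v ≠ g → (T v < T u ↔ e v < e u) := by
    intro v hv
    refine ⟨fun hlt => ?_, h v u hv hu⟩
    rcases lt_trichotomy (e v) (e u) with h1 | h1 | h1
    · exact h1
    · rw [e.injective h1] at hlt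
      exact absurd hlt (lt_irrefl _)
    · exact absurd (h u v hu hv h1) hlt.not_gt
  have heq : ((Finset.Iio (e u)).erase (e g)).card = ((Finset.Iio (T u)).erase (T g)).card := by
    refine Finset.card_bij (fun p _ => T (e.symm p)) ?_ ?_ ?_
    · intro p hp
      simp only [Finset.mem_erase, Finset.mem_Iio] at hp ⊢
      have hv : e.symm p ≠ g := fun hv => hp.1 (by simp [← hv])
      exact ⟨fun h' => hv (T.injective h'), (hiff _ hv).2 (by simpa using hp.2)⟩
    · intro p _ p' _ hpp
      simpa using hpp
    · intro p hp
      simp only [Finset.mem_erase, Finset.mem_Iio] at hp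
      have hv : T.symm p ≠ g := fun hv => hp.1 (by simp [← hv])
      refine ⟨e (T.symm p), ?_, by simp⟩
      simp only [Finset.mem_erase, Finset.mem_Iio]
      exact ⟨fun h' => hv (e.injective h'), (hiff _ hv).1 (by simpa using hp.2)⟩
  rw [heq]
  exact card T

/-- If two votes agree off `g`, then the position of another candidate changes only when `g`
overtakes it or is overtaken by it, and then by exactly one. -/
lemma position_cases {C : Type*} {m : ℕ} (e T : C ≃ Fin m) (g : C)
    (h : ∀ u v, u ≠ g → v ≠ g → e u < e v → T u < T v) (u : C) (hu : u ≠ g) :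
    ((e u : ℕ) < e g ∧ (e u : ℕ) < T g ∧ (T u : ℕ) = e u) ∨
    ((e u : ℕ) < e g ∧ (T g : ℕ) ≤ e u ∧ (T u : ℕ) = e u + 1) ∨
    ((e g : ℕ) < e u ∧ (T g : ℕ) < e u ∧ (T u : ℕ) = e u) ∨
    ((e g : ℕ) < e u ∧ (e u : ℕ) ≤ T g ∧ (T u : ℕ) + 1 = e u) := by
  obtain ⟨r, h1, h2⟩ := exists_common_rank e T g h u hu
  have hne : (e u : ℕ) ≠ e g := fun h => hu (e.injective (Fin.ext h))
  have hne' : (T u : ℕ) ≠ T g := fun h => hu (T.injective (Fin.ext h))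
  simp only [Fin.lt_def] at h1 h2
  split_ifs at h1 h2 <;> omega

/-- A candidate can be moved to the last position of a vote without changing the relative
order of the other candidates. -/
lemma exists_move_last {C : Type*} {m : ℕ} (e : C ≃ Fin m) (g : C) :
    ∃ T : C ≃ Fin m, (T g : ℕ) + 1 = m ∧
      ∀ u v, u ≠ g → v ≠ g → e u < e v → T u < T v := by
  let f : Fin m → Fin m := fun k =>
    ⟨if k = e g then m - 1 else if e g < k then k - 1 else k, by split_ifs <;> omega⟩
  have hval : ∀ k, (f k : ℕ) = if (k : ℕ) = e g then m - 1 else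
      if (e g : ℕ) < k then k - 1 else k := by
    intro k
    simp only [f, Fin.ext_iff, Fin.lt_def]
  have hf : Function.Injective f := by
    intro k k' hk
    have h1 : (f k : ℕ) = f k' := congrArg Fin.val hk
    rw [hval, hval] at h1
    ext
    split_ifs at h1 <;> omega
  refine ⟨e.trans (Equiv.ofBijective f (Finite.injective_iff_bijective.1 hf)), ?_, ?_⟩
  · simp only [Equiv.trans_apply, Equiv.ofBijective_apply, hval]
    have := (e g).2
    simp; omega
  · intro u v hu hv huv
    have hu' : (e u : ℕ) ≠ e g := fun h => hu (e.injective (Fin.ext h))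
    have hv' : (e v : ℕ) ≠ e g := fun h => hv (e.injective (Fin.ext h))
    simp only [Equiv.trans_apply, Equiv.ofBijective_apply, Fin.lt_def, hval] at huv ⊢
    simp only [hu', hv', if_false]
    split_ifs <;> omega

lemma sum_add_le_sum_add_of_subsingleton {ι : Type*} [Fintype ι] {f f' : ι → ℕ}
    {p : ι → Prop} {b b' : ℕ} (hbb : b' ≤ b) (hp : ∀ i j, p i → p j → i = j)
    (hne : ∀ i, ¬ p i → f i = f' i) (hf : ∀ i, p i → f i = b) (hf' : ∀ i, p i → f' i = b') :
    ∑ i, f i + b' ≤ ∑ i, f' i + b := by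
  classical
  by_cases h : ∃ i, p i
  · obtain ⟨i, hi⟩ := h
    have hrest : ∑ j ∈ Finset.univ.erase i, f j = ∑ j ∈ Finset.univ.erase i, f' j :=
      Finset.sum_congr rfl fun j hj => hne j fun hj' => (Finset.mem_erase.1 hj).1 (hp j i hj' hi)
    rw [← Finset.add_sum_erase _ f (Finset.mem_univ i),
      ← Finset.add_sum_erase _ f' (Finset.mem_univ i), hf i hi, hf' i hi, hrest]
    omega
  · push Not at h
    have hall : ∑ i, f i = ∑ i, f' i := Finset.sum_congr rfl fun i _ => hne i (h i)
    omega

lemma sum_add_two_mul_le {ι : Type*} [Fintype ι] {f f' : ι → ℕ} {b b' : ℕ}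
    (hle : ∀ i, f' i ≤ f i) {i j : ι} (hij : i ≠ j) (hi : f i = b) (hj : f j = b)
    (hi' : f' i = b') (hj' : f' j = b') :
    ∑ k, f' k + 2 * b ≤ ∑ k, f k + 2 * b' := by
  classical
  have hmem : j ∈ Finset.univ.erase i := by simp [hij.symm]
  rw [← Finset.add_sum_erase _ f (Finset.mem_univ i), ← Finset.add_sum_erase _ f hmem,
    ← Finset.add_sum_erase _ f' (Finset.mem_univ i), ← Finset.add_sum_erase _ f' hmem]
  have := Finset.sum_le_sum fun k (_ : k ∈ (Finset.univ.erase i).erase j) => hle k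
  omega

lemma sum_ite_mem_const {ι : Type*} [Fintype ι] [DecidableEq ι] (K : Finset ι) (b b' : ℕ) :
    ∑ i, (if i ∈ K then b else b') + K.card * b' = Fintype.card ι * b' + K.card * b := by
  have h := Finset.card_add_card_compl K
  rw [Finset.sum_ite]
  simp only [Finset.sum_const, smul_eq_mul]
  have h1 : (Finset.univ.filter fun i => i ∈ K) = K := by ext; simp
  have h2 : (Finset.univ.filter fun i => i ∉ K) = Kᶜ := by ext; simp
  rw [h1, h2, ← h]
  ring

/-- in Reduction 3 (unbounded case: `m' = 3q+4` distinct values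
`a 0 > a 1 > … > a (3q+3)` with multiplicities `ℓ`, `pᵢ` obtained from `p'ᵢ` by deleting
`g`, and `Q` satisfying the stated score conditions with `λ = s(P'∪Q, c)`), the
distinguished candidate `c` is a possible winner of `P ∪ Q` under `s` iff the 3DM
instance is positive. -/
theorem stmt10 (q t m : ℕ) (hq : 1 ≤ q)
    (a : Fin (3 * q + 4) → ℕ) (haAnti : StrictAnti a)
    (ℓ : Fin (3 * q + 4) → ℕ) (hℓ : ∀ j, 1 ≤ ℓ j)
    (hm : m = prefL (3 * q + 4) ℓ (3 * q + 4))
    (s : Fin m → ℕ)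
    (hs : ∀ (pos : Fin m) (j : Fin (3 * q + 4)),
      prefL (3 * q + 4) ℓ (j : ℕ) ≤ (pos : ℕ) →
      (pos : ℕ) < prefL (3 * q + 4) ℓ ((j : ℕ) + 1) → s pos = a j)
    (S : Fin t → Fin q × Fin q × Fin q)
    (p' : Fin t → (CandU q ℓ ≃ Fin m))
    (hgpos : ∀ i, (p' i CandU.g).val = prefL (3 * q + 4) ℓ (3 * q - 1))
    (hdpos : ∀ i, (p' i CandU.d).val = prefL (3 * q + 4) ℓ (3 * q))
    (hxpos : ∀ i, (p' i (CandU.x (S i).1)).val = prefL (3 * q + 4) ℓ (3 * q + 1))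
    (hypos : ∀ i, (p' i (CandU.y (S i).2.1)).val = prefL (3 * q + 4) ℓ (3 * q + 2))
    (hzpos : ∀ i, (p' i (CandU.z (S i).2.2)).val = prefL (3 * q + 4) ℓ (3 * q + 3))
    (hhpos : ∀ (i : Fin t) (j : Fin (3 * q + 4)) (k : Fin (ℓ j - 1)),
      prefL (3 * q + 4) ℓ (j : ℕ) ≤ (p' i (CandU.h j k)).val ∧
      (p' i (CandU.h j k)).val < prefL (3 * q + 4) ℓ ((j : ℕ) + 1))
    (hcw : ∀ i, p' i CandU.c < p' i CandU.w)
    (Q : List (CandU q ℓ ≃ Fin m))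
    (lam : ℕ) (hlam : score s (List.ofFn p' ++ Q) CandU.c = lam)
    (hX : ∀ ix : Fin q, score s (List.ofFn p' ++ Q) (CandU.x ix) + a ⟨3 * q, by omega⟩ =
      lam + a ⟨3 * q + 1, by omega⟩)
    (hY : ∀ iy : Fin q, score s (List.ofFn p' ++ Q) (CandU.y iy) + a ⟨3 * q + 1, by omega⟩ =
      lam + a ⟨3 * q + 2, by omega⟩)
    (hZ : ∀ iz : Fin q, score s (List.ofFn p' ++ Q) (CandU.z iz) + a ⟨3 * q + 2, by omega⟩ =
      lam + a ⟨3 * q + 3, by omega⟩)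
    (hG : score s (List.ofFn p' ++ Q) CandU.g + q * a ⟨3 * q + 3, by omega⟩ =
      lam + q * a ⟨3 * q - 1, by omega⟩)
    (hD : score s (List.ofFn p' ++ Q) CandU.d + q * a ⟨3 * q - 1, by omega⟩ =
      lam + q * a ⟨3 * q, by omega⟩)
    (hH : ∀ (j : Fin (3 * q + 4)) (k : Fin (ℓ j - 1)),
      score s (List.ofFn p' ++ Q) (CandU.h j k) = lam)
    (hW : score s (List.ofFn p' ++ Q) CandU.w < lam) :
    (∃ T : Fin t → (CandU q ℓ ≃ Fin m),
      (∀ (i : Fin t) (u v : CandU q ℓ),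
        u ≠ CandU.g → v ≠ CandU.g → p' i u < p' i v → T i u < T i v) ∧
      ∀ c', score s (List.ofFn T ++ Q) c' ≤ score s (List.ofFn T ++ Q) CandU.c) ↔
    (∃ K : Finset (Fin t), K.card = q ∧
      ∀ i ∈ K, ∀ j ∈ K, i ≠ j →
        (S i).1 ≠ (S j).1 ∧ (S i).2.1 ≠ (S j).2.1 ∧ (S i).2.2 ≠ (S j).2.2) := by
  set L := prefL (3 * q + 4) ℓ
  have hLt : ∀ k, k < 3 * q + 4 → L k < L (k + 1) := by
    intro k hk
    have h1 : L (k + 1) = L k + ℓ ⟨k, hk⟩ := prefL_succ ℓ ⟨k, hk⟩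
    have h2 := hℓ ⟨k, hk⟩
    omega
  have hLmono : Monotone L := prefL_mono ℓ
  have hblock : ∀ p : Fin m, ∃ j : Fin (3 * q + 4), L j ≤ p ∧ (p : ℕ) < L (j + 1) :=
    fun p => exists_block ℓ (p.2.trans_eq hm)
  have hlow : ∀ (p : Fin m) (k : ℕ) (hk : k < 3 * q + 4),
      (p : ℕ) < L (k + 1) → a ⟨k, hk⟩ ≤ s p := by
    intro p k hk hp
    obtain ⟨j, h1, h2⟩ := hblock p
    rw [hs p j h1 h2]
    refine haAnti.antitone ?_
    by_contra hlt
    have := hLmono (show k + 1 ≤ (j : ℕ) by simpa [Fin.lt_def] using hlt)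
    omega
  have hupp : ∀ (p : Fin m) (k : ℕ) (hk : k < 3 * q + 4),
      L k ≤ (p : ℕ) → s p ≤ a ⟨k, hk⟩ := by
    intro p k hk hp
    obtain ⟨j, h1, h2⟩ := hblock p
    rw [hs p j h1 h2]
    refine haAnti.antitone ?_
    by_contra hlt
    have := hLmono (show (j : ℕ) + 1 ≤ k by simpa [Fin.lt_def] using hlt)
    omega
  have hsanti : Antitone s := by
    intro p p' hpp
    obtain ⟨j, h1, h2⟩ := hblock p
    rw [hs p j h1 h2]
    exact hupp p' j j.2 (h1.trans hpp)
  have hval : ∀ (p : Fin m) (k : ℕ) (hk : k < 3 * q + 4),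
      L k ≤ (p : ℕ) → (p : ℕ) < L (k + 1) → s p = a ⟨k, hk⟩ :=
    fun p k hk h1 h2 => hs p ⟨k, hk⟩ h1 h2
  have hL0 : L (3 * q - 1) < L (3 * q) := by
    simpa [show 3 * q - 1 + 1 = 3 * q by omega] using hLt (3 * q - 1) (by omega)
  have hL1 := hLt (3 * q) (by omega)
  have hL2 := hLt (3 * q + 1) (by omega)
  have hL3 := hLt (3 * q + 2) (by omega)
  have hL4 : L (3 * q + 3) < m := by rw [hm]; exact hLt (3 * q + 3) (by omega)
  have hAB : a ⟨3 * q, by omega⟩ < a ⟨3 * q - 1, by omega⟩ :=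
    haAnti (by simp only [Fin.lt_def]; omega)
  have hA' : a ⟨3 * q - 1, by omega⟩ < a ⟨3 * q - 2, by omega⟩ :=
    haAnti (by simp only [Fin.lt_def]; omega)
  have hBC : a ⟨3 * q + 1, by omega⟩ < a ⟨3 * q, by omega⟩ :=
    haAnti (by simp only [Fin.lt_def]; omega)
  have hCD : a ⟨3 * q + 2, by omega⟩ < a ⟨3 * q + 1, by omega⟩ :=
    haAnti (by simp only [Fin.lt_def]; omega)
  have hDE : a ⟨3 * q + 3, by omega⟩ < a ⟨3 * q + 2, by omega⟩ :=
    haAnti (by simp only [Fin.lt_def]; omega)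
  -- a block contains a single candidate that is not a dummy
  have huniq : ∀ (i : Fin t) (j : Fin (3 * q + 4)) (u v : CandU q ℓ),
      (∀ j k, u ≠ CandU.h j k) → (∀ j k, v ≠ CandU.h j k) →
      L j ≤ (p' i u).val → (p' i u).val < L (j + 1) →
      L j ≤ (p' i v).val → (p' i v).val < L (j + 1) → u = v := by
    intro i j u v hu hv hu1 hu2 hv1 hv2
    by_contra huv
    let f : Option (Option (Fin (ℓ j - 1))) → CandU q ℓ := fun o =>
      match o with
      | none => u
      | some none => v
      | some (some k) => CandU.h j k
    have hf : Function.Injective f := by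
      rintro (_ | _ | k) (_ | _ | k') hkk
      · rfl
      · exact absurd hkk huv
      · exact absurd hkk (hu j k')
      · exact absurd hkk.symm huv
      · rfl
      · exact absurd hkk (hv j k')
      · exact absurd hkk.symm (hu j k)
      · exact absurd hkk.symm (hv j k)
      · simpa [f] using hkk
    have hcard := Finset.card_le_card_of_injOn (s := Finset.univ)
      (t := Finset.Ico (L j) (L (j + 1))) (fun o => (p' i (f o)).val)
      (by
        rintro (_ | _ | k) _
        · simpa [f] using ⟨hu1, hu2⟩
        · simpa [f] using ⟨hv1, hv2⟩
        · simpa [f] using hhpos i j k)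
      (fun o _ o' _ hoo => hf ((p' i).injective (Fin.ext hoo)))
    have h1 : L (j + 1) = L j + ℓ j := prefL_succ ℓ j
    have h2 := hℓ j
    simp only [Finset.card_univ, Fintype.card_option, Fintype.card_fin, Nat.card_Ico] at hcard
    omega
  have hbefore : ∀ (i : Fin t) (u : CandU q ℓ), (∀ j k, u ≠ CandU.h j k) → u ≠ CandU.g →
      u ≠ CandU.d → u ≠ CandU.x (S i).1 → u ≠ CandU.y (S i).2.1 → u ≠ CandU.z (S i).2.2 →
      (p' i u).val < (p' i CandU.g).val := by
    intro i u hu hug hud hux huy huz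
    by_contra hlt
    obtain ⟨j, h1, h2⟩ := hblock (p' i u)
    have hj : 3 * q - 1 ≤ j := by
      by_contra hj
      have := hLmono (show (j : ℕ) + 1 ≤ 3 * q - 1 by omega)
      have := hgpos i
      omega
    have hfirst : ∀ v, (∀ j k, v ≠ CandU.h j k) → (p' i v).val = L j → u = v := by
      intro v hv hvj
      exact huniq i j u v hu hv h1 h2 hvj.ge (hvj.trans_lt (hLt j j.2))
    have hj5 : (j : ℕ) = 3 * q - 1 ∨ (j : ℕ) = 3 * q ∨ (j : ℕ) = 3 * q + 1 ∨
        (j : ℕ) = 3 * q + 2 ∨ (j : ℕ) = 3 * q + 3 := by omega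
    rcases hj5 with hj | hj | hj | hj | hj <;> rw [hj] at hfirst
    · exact hug (hfirst _ (by simp) (hgpos i))
    · exact hud (hfirst _ (by simp) (hdpos i))
    · exact hux (hfirst _ (by simp) (hxpos i))
    · exact huy (hfirst _ (by simp) (hypos i))
    · exact huz (hfirst _ (by simp) (hzpos i))
  have hsg : ∀ i, s (p' i CandU.g) = a ⟨3 * q - 1, by omega⟩ := fun i =>
    hval _ _ _ (hgpos i).ge (by
      rw [hgpos i, show 3 * q - 1 + 1 = 3 * q by omega]; exact hL0)
  have hsd : ∀ i, s (p' i CandU.d) = a ⟨3 * q, by omega⟩ := fun i =>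
    hval _ _ _ (hdpos i).ge ((hdpos i).trans_lt hL1)
  have hsx : ∀ i, s (p' i (CandU.x (S i).1)) = a ⟨3 * q + 1, by omega⟩ := fun i =>
    hval _ _ _ (hxpos i).ge ((hxpos i).trans_lt hL2)
  have hsy : ∀ i, s (p' i (CandU.y (S i).2.1)) = a ⟨3 * q + 2, by omega⟩ := fun i =>
    hval _ _ _ (hypos i).ge ((hypos i).trans_lt hL3)
  have hsz : ∀ i, s (p' i (CandU.z (S i).2.2)) = a ⟨3 * q + 3, by omega⟩ := fun i =>
    hval _ _ _ (hzpos i).ge ((hzpos i).trans_lt (hLt _ (by omega)))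
  -- just before the first position of a block, the score is the value of the preceding block
  have hpromote : ∀ (p : Fin m) (k : ℕ) (hk : k < 3 * q + 4),
      (p : ℕ) + 1 = L (k + 1) → s p = a ⟨k, hk⟩ := fun p k hk hp =>
    hval p k hk (by have := hLt k hk; omega) (by omega)
  simp only [score_ofFn_append] at *
  constructor
  · rintro ⟨T, hT, hwin⟩
    have hpos := fun i => position_cases (p' i) (T i) CandU.g (hT i)
    let K : Finset (Fin t) := Finset.univ.filter fun i => L (3 * q) ≤ (T i CandU.g).val
    have hK : ∀ i, i ∈ K ↔ L (3 * q) ≤ (T i CandU.g).val := fun i => by simp [K]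
    have hc : ∑ i, s (T i CandU.c) ≤ ∑ i, s (p' i CandU.c) := by
      refine Finset.sum_le_sum fun i _ => hsanti ?_
      have h1 := hbefore i CandU.c (by simp) (by simp) (by simp) (by simp) (by simp) (by simp)
      have h2 := hpos i CandU.c (by simp)
      simp only [Fin.le_def]
      omega
    have hd : ∑ i, s (T i CandU.d) =
        ∑ i, if i ∈ K then a ⟨3 * q - 1, by omega⟩ else a ⟨3 * q, by omega⟩ := by
      refine Finset.sum_congr rfl fun i _ => ?_
      have h1 := hpos i CandU.d (by simp)
      have h2 := hdpos i
      have h3 := hgpos i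
      split_ifs with hi <;> rw [hK] at hi
      · exact hpromote _ _ _ (by rw [show 3 * q - 1 + 1 = 3 * q by omega]; omega)
      · rw [← hsd i]
        congr 1
        ext
        omega
    have hg : ∀ i, (if i ∈ K then a ⟨3 * q + 3, by omega⟩ else a ⟨3 * q - 1, by omega⟩) ≤
        s (T i CandU.g) := by
      intro i
      split_ifs with hi <;> rw [hK] at hi
      · exact hlow _ _ _ ((T i CandU.g).2.trans_eq hm)
      · exact hlow _ _ _ (by rw [show 3 * q - 1 + 1 = 3 * q by omega]; omega)
    have hgsum := Finset.sum_le_sum fun i (_ : i ∈ Finset.univ) => hg i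
    have hcount := sum_ite_mem_const K (a ⟨3 * q + 3, by omega⟩) (a ⟨3 * q - 1, by omega⟩)
    have hcount' := sum_ite_mem_const K (a ⟨3 * q - 1, by omega⟩) (a ⟨3 * q, by omega⟩)
    have hg0 : ∑ i, s (p' i CandU.g) = t * a ⟨3 * q - 1, by omega⟩ := by simp [hsg]
    have hd0 : ∑ i, s (p' i CandU.d) = t * a ⟨3 * q, by omega⟩ := by simp [hsd]
    have hwd := hwin CandU.d
    have hwg := hwin CandU.g
    rw [Fintype.card_fin] at hcount hcount'
    have hKle : K.card ≤ q := by
      by_contra hlt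
      have := Nat.mul_lt_mul_of_pos_left hAB (show 0 < K.card - q by omega)
      obtain ⟨e, he⟩ : ∃ e, K.card = q + e := ⟨K.card - q, by omega⟩
      rw [he] at hcount' this
      simp only [add_tsub_cancel_left, add_mul] at hcount' this
      omega
    have hKge : q ≤ K.card := by
      by_contra hlt
      have := Nat.mul_lt_mul_of_pos_left (hDE.trans (hCD.trans (hBC.trans hAB)))
        (show 0 < q - K.card by omega)
      obtain ⟨e, he⟩ : ∃ e, q = K.card + e := ⟨q - K.card, by omega⟩
      rw [show q - K.card = e by omega] at this
      have h1 : ∀ b, q * b = K.card * b + e * b := fun b => by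
        rw [← add_mul, ← he]
      rw [h1, h1] at hG
      omega
    have hKq : K.card = q := le_antisymm hKle hKge
    rw [hKq] at hcount
    have hgeq := (Finset.sum_eq_sum_iff_of_le fun i (_ : i ∈ Finset.univ) => hg i).1
      (le_antisymm hgsum (by omega))
    have hlast : ∀ i ∈ K, L (3 * q + 3) ≤ (T i CandU.g).val := by
      intro i hi
      have h1 := hgeq i (Finset.mem_univ i)
      rw [if_pos hi] at h1
      by_contra hlt
      have := hlow (T i CandU.g) (3 * q + 2) (by omega) (not_le.1 hlt)
      omega
    have hstay : ∀ i, (p' i CandU.g).val ≤ (T i CandU.g).val := by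
      intro i
      rw [hgpos i]
      by_cases hi : i ∈ K
      · have := (hK i).1 hi
        omega
      · have h1 := hgeq i (Finset.mem_univ i)
        rw [if_neg hi] at h1
        by_contra hlt
        have := hlow (T i CandU.g) (3 * q - 2) (by omega)
          (by rw [show 3 * q - 2 + 1 = 3 * q - 1 by omega]; omega)
        omega
    have hmono : ∀ u, u ≠ CandU.g → ∀ i, s (p' i u) ≤ s (T i u) := by
      intro u hu i
      refine hsanti ?_
      have h1 := hpos i u hu
      have h2 := hstay i
      simp only [Fin.le_def]
      omega
    have hshift : ∀ i ∈ K, ∀ u, u ≠ CandU.g → ∀ k (hk : k < 3 * q + 3), 3 * q ≤ k →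
        (p' i u).val = L (k + 1) → s (T i u) = a ⟨k, by omega⟩ := by
      intro i hi u hu k hk hqk hpu
      refine hpromote _ _ _ ?_
      have h1 := hpos i u hu
      have h2 := hlast i hi
      have h3 := hgpos i
      have h4 := hLmono (show k + 1 ≤ 3 * q + 3 by omega)
      have h5 := hLmono (show 3 * q ≤ k + 1 by omega)
      omega
    refine ⟨K, hKq, fun i hi j hj hij => ⟨fun h => ?_, fun h => ?_, fun h => ?_⟩⟩
    · have h1 := sum_add_two_mul_le (hmono (CandU.x (S i).1) (by simp)) hij
        (hshift i hi _ (by simp) (3 * q) (by omega) le_rfl (hxpos i))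
        (hshift j hj _ (by simp) (3 * q) (by omega) le_rfl (h ▸ hxpos j))
        (hsx i) (h ▸ hsx j)
      have h2 := hX (S i).1
      have h3 := hwin (CandU.x (S i).1)
      omega
    · have h1 := sum_add_two_mul_le (hmono (CandU.y (S i).2.1) (by simp)) hij
        (hshift i hi _ (by simp) (3 * q + 1) (by omega) (by omega) (hypos i))
        (hshift j hj _ (by simp) (3 * q + 1) (by omega) (by omega) (h ▸ hypos j))
        (hsy i) (h ▸ hsy j)
      have h2 := hY (S i).2.1
      have h3 := hwin (CandU.y (S i).2.1)
      omega
    · have h1 := sum_add_two_mul_le (hmono (CandU.z (S i).2.2) (by simp)) hij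
        (hshift i hi _ (by simp) (3 * q + 2) (by omega) (by omega) (hzpos i))
        (hshift j hj _ (by simp) (3 * q + 2) (by omega) (by omega) (h ▸ hzpos j))
        (hsz i) (h ▸ hsz j)
      have h2 := hZ (S i).2.2
      have h3 := hwin (CandU.z (S i).2.2)
      omega
  · rintro ⟨K, hKq, hK⟩
    choose M hMlast hMord using fun i => exists_move_last (p' i) CandU.g
    have hpos := fun i => position_cases (p' i) (M i) CandU.g (hMord i)
    have hMbefore : ∀ i u, (p' i u).val < (p' i CandU.g).val → M i u = p' i u := by
      intro i u hu
      have h1 := hpos i u (by rintro rfl; exact lt_irrefl _ hu)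
      have h2 := hMlast i
      have h3 := (p' i CandU.g).2
      ext
      omega
    have hMafter : ∀ i u, (p' i CandU.g).val < (p' i u).val →
        (M i u).val + 1 = (p' i u).val := by
      intro i u hu
      have h1 := hpos i u (by rintro rfl; exact lt_irrefl _ hu)
      have h2 := hMlast i
      have h3 := (p' i u).2
      omega
    have hshift : ∀ i u k (hk : k < 3 * q + 3), 3 * q - 1 ≤ k →
        (p' i u).val = L (k + 1) → s (M i u) = a ⟨k, by omega⟩ := by
      intro i u k hk hqk hpu
      refine hpromote _ _ _ ?_
      rw [hMafter i u, hpu]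
      have h3 := hgpos i
      have h5 := hLmono (show 3 * q ≤ k + 1 by omega)
      omega
    have hMg : ∀ i, s (M i CandU.g) = a ⟨3 * q + 3, by omega⟩ := by
      intro i
      have h1 := hMlast i
      exact hval _ _ _ (by omega) ((M i CandU.g).2.trans_eq hm)
    have hMd : ∀ i, s (M i CandU.d) = a ⟨3 * q - 1, by omega⟩ := fun i =>
      hshift i _ (3 * q - 1) (by omega) le_rfl
        (by rw [show 3 * q - 1 + 1 = 3 * q by omega]; exact hdpos i)
    have hMh : ∀ i j k, s (M i (CandU.h j k)) = s (p' i (CandU.h j k)) := by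
      intro i j k
      have hne : (p' i (CandU.h j k)).val ≠ (p' i CandU.g).val := fun h => by
        simpa using (p' i).injective (Fin.ext h)
      rcases Nat.lt_or_gt_of_ne hne with hlt | hgt
      · rw [hMbefore i _ hlt]
      · obtain ⟨h1, h2⟩ := hhpos i j k
        have h3 := hMafter i _ hgt
        have hj : 3 * q - 1 ≤ j := by
          by_contra hj
          have := hLmono (show (j : ℕ) + 1 ≤ 3 * q - 1 by omega)
          have := hgpos i
          omega
        have hfirst : ∀ v, (∀ j k, v ≠ CandU.h j k) → (p' i v).val = L j →
            (p' i (CandU.h j k)).val ≠ L j := by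
          intro v hv hvj h
          exact hv j k ((p' i).injective (Fin.ext (hvj.trans h.symm)))
        have hnot : (p' i (CandU.h j k)).val ≠ L j := by
          have hj5 : (j : ℕ) = 3 * q - 1 ∨ (j : ℕ) = 3 * q ∨ (j : ℕ) = 3 * q + 1 ∨
              (j : ℕ) = 3 * q + 2 ∨ (j : ℕ) = 3 * q + 3 := by omega
          rcases hj5 with hj | hj | hj | hj | hj
          · exact hfirst CandU.g (by simp) (by rw [hj]; exact hgpos i)
          · exact hfirst CandU.d (by simp) (by rw [hj]; exact hdpos i)
          · exact hfirst (CandU.x (S i).1) (by simp) (by rw [hj]; exact hxpos i)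
          · exact hfirst (CandU.y (S i).2.1) (by simp) (by rw [hj]; exact hypos i)
          · exact hfirst (CandU.z (S i).2.2) (by simp) (by rw [hj]; exact hzpos i)
        rw [hs _ j h1 h2]
        exact hs _ j (by omega) (by omega)
    let T : Fin t → (CandU q ℓ ≃ Fin m) := fun i => if i ∈ K then M i else p' i
    have hTin : ∀ i ∈ K, T i = M i := fun i hi => if_pos hi
    have hTout : ∀ i, i ∉ K → T i = p' i := fun i hi => if_neg hi
    have hsame : ∀ u, (∀ i ∈ K, s (M i u) = s (p' i u)) →
        ∑ i, s (T i u) = ∑ i, s (p' i u) := by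
      intro u hu
      refine Finset.sum_congr rfl fun i _ => ?_
      by_cases hi : i ∈ K
      · rw [hTin i hi, hu i hi]
      · rw [hTout i hi]
    have hconst : ∀ u b b', (∀ i, s (M i u) = b) → (∀ i, s (p' i u) = b') →
        ∑ i, s (T i u) + q * b' = ∑ i, s (p' i u) + q * b := by
      intro u b b' hb hb'
      have h1 := sum_ite_mem_const K b b'
      have h2 : ∑ i, s (T i u) = ∑ i, if i ∈ K then b else b' := by
        refine Finset.sum_congr rfl fun i _ => ?_
        split_ifs with hi
        · rw [hTin i hi, hb]
        · rw [hTout i hi, hb']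
      have h3 : ∑ i, s (p' i u) = t * b' := by simp [hb']
      rw [hKq, Fintype.card_fin] at h1
      omega
    have helem : ∀ (u : CandU q ℓ) (f : Fin t → Prop) (b b' : ℕ), b' ≤ b →
        (∀ i ∈ K, ∀ j ∈ K, f i → f j → i = j) →
        (∀ i, ¬ f i → (p' i u).val < (p' i CandU.g).val) →
        (∀ i, f i → s (M i u) = b) → (∀ i, f i → s (p' i u) = b') →
        ∑ i, s (T i u) + b' ≤ ∑ i, s (p' i u) + b := by
      intro u f b b' hbb huni hnot hb hb'
      refine sum_add_le_sum_add_of_subsingleton (p := fun i => i ∈ K ∧ f i) hbb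
        (fun i j hi hj => huni i hi.1 j hj.1 hi.2 hj.2) (fun i hi => ?_)
        (fun i hi => by rw [hTin i hi.1, hb i hi.2]) (fun i hi => hb' i hi.2)
      by_cases hiK : i ∈ K
      · rw [hTin i hiK, hMbefore i u (hnot i fun hf => hi ⟨hiK, hf⟩)]
      · rw [hTout i hiK]
    have hc : ∑ i, s (T i CandU.c) = ∑ i, s (p' i CandU.c) :=
      hsame _ fun i _ => by rw [hMbefore i _ (hbefore i _ (by simp) (by simp) (by simp)
        (by simp) (by simp) (by simp))]
    refine ⟨T, fun i u v hu hv huv => ?_, fun u => ?_⟩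
    · by_cases hi : i ∈ K
      · rw [hTin i hi]
        exact hMord i u v hu hv huv
      · rwa [hTout i hi]
    · rw [hc, hlam]
      cases u with
      | x ix =>
        have h1 := helem (CandU.x ix) (fun i => (S i).1 = ix) _ _ hBC.le
          (fun i hi j hj h h' => by_contra fun hij => (hK i hi j hj hij).1 (h.trans h'.symm))
          (fun i hi => hbefore i _ (by simp) (by simp) (by simp) (by simpa using Ne.symm hi)
            (by simp) (by simp))
          (fun i hi => hi ▸ hshift i _ (3 * q) (by omega) (by omega) (hxpos i))
          (fun i hi => hi ▸ hsx i)
        have h2 := hX ix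
        omega
      | y iy =>
        have h1 := helem (CandU.y iy) (fun i => (S i).2.1 = iy) _ _ hCD.le
          (fun i hi j hj h h' => by_contra fun hij => (hK i hi j hj hij).2.1 (h.trans h'.symm))
          (fun i hi => hbefore i _ (by simp) (by simp) (by simp) (by simp)
            (by simpa using Ne.symm hi) (by simp))
          (fun i hi => hi ▸ hshift i _ (3 * q + 1) (by omega) (by omega) (hypos i))
          (fun i hi => hi ▸ hsy i)
        have h2 := hY iy
        omega
      | z iz =>
        have h1 := helem (CandU.z iz) (fun i => (S i).2.2 = iz) _ _ hDE.le
          (fun i hi j hj h h' => by_contra fun hij => (hK i hi j hj hij).2.2 (h.trans h'.symm))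
          (fun i hi => hbefore i _ (by simp) (by simp) (by simp) (by simp) (by simp)
            (by simpa using Ne.symm hi))
          (fun i hi => hi ▸ hshift i _ (3 * q + 2) (by omega) (by omega) (hzpos i))
          (fun i hi => hi ▸ hsz i)
        have h2 := hZ iz
        omega
      | c => rw [hc, hlam]
      | g =>
        have h1 := hconst _ _ _ hMg hsg
        omega
      | d =>
        have h1 := hconst _ _ _ hMd hsd
        omega
      | w =>
        have h1 : ∑ i, s (T i CandU.w) = ∑ i, s (p' i CandU.w) :=
          hsame _ fun i _ => by rw [hMbefore i _ (hbefore i _ (by simp) (by simp) (by simp)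
            (by simp) (by simp) (by simp))]
        rw [h1]
        exact hW.le
      | h j k =>
        rw [hsame _ fun i _ => hMh i j k]
        exact (hH j k).le
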